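/- arXiv:1606.02058 — 3 statements merged into one kernel-verified Lean document; each statement's English description precedes it below -/
import Mathlib

section
/- Let H, j, N, A, B, Q_σ, λ_j(σ) be as in the min–max setting. Let σ₁, σ₂ ∈ [0,1) satisfy (1+N)·|σ₁−σ₂| < 1−min{σ₁,σ₂}, and assume λ_j(min{σ₁,σ₂}) < ∞. Then λ_j(σ₁) and λ_j(σ₂) are finite and |λ_j(σ₁) − λ_j(σ₂)| ≤ (1+N)·(λ_j(min{σ₁,σ₂})/(1−min{σ₁,σ₂}))·|σ₁−σ₂|. -/
open scoped ENNReal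

/-- The `j`-th min–max value of a functional `Q` on a real inner product space. -/
noncomputable def minmaxVal {H : Type*} [NormedAddCommGroup H] [InnerProductSpace ℝ H]
    (j : ℕ) (Q : H → ℝ) : ℝ≥0∞ :=
  ⨅ (E : Submodule ℝ H) (_ : Module.finrank ℝ E = j),
    ⨆ (u : H) (_ : u ∈ E) (_ : u ≠ 0), ENNReal.ofReal (Q u / ‖u‖ ^ 2)

theorem minmaxVal_le_ofReal_mul {H : Type*} [NormedAddCommGroup H] [InnerProductSpace ℝ H]
    (j : ℕ) {P Q : H → ℝ} {c : ℝ} (hc : 0 < c) (h : ∀ u, P u ≤ c * Q u) :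
    minmaxVal j P ≤ ENNReal.ofReal c * minmaxVal j Q := by
  have hc0 : ENNReal.ofReal c ≠ 0 := by simpa using hc
  simp only [minmaxVal, ENNReal.mul_iInf_of_ne hc0 ENNReal.ofReal_ne_top, ENNReal.mul_iSup]
  gcongr with E hE u hu hu0
  rw [← ENNReal.ofReal_mul hc.le, ← mul_div_assoc]
  gcongr
  exact h u

/-- If `Q` is a relative perturbation of `P` of size `c < 1`, then so are the min–max values. -/
theorem minmaxVal_lt_top_and_abs_sub_le {H : Type*} [NormedAddCommGroup H]
    [InnerProductSpace ℝ H] (j : ℕ) {P Q : H → ℝ} {c : ℝ} (hc0 : 0 ≤ c) (hc1 : c < 1)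
    (h : ∀ u, |Q u - P u| ≤ c * P u) (hP : minmaxVal j P < ⊤) :
    minmaxVal j Q < ⊤ ∧
      |(minmaxVal j P).toReal - (minmaxVal j Q).toReal| ≤ c * (minmaxVal j P).toReal := by
  have hc : 0 < 1 - c := by linarith
  have hupper : minmaxVal j Q ≤ ENNReal.ofReal (1 + c) * minmaxVal j P :=
    minmaxVal_le_ofReal_mul j (by linarith) fun u => by linarith [(abs_le.1 (h u)).2]
  have hlower : minmaxVal j P ≤ ENNReal.ofReal (1 - c)⁻¹ * minmaxVal j Q :=
    minmaxVal_le_ofReal_mul j (inv_pos.2 hc) fun u => by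
      rw [le_inv_mul_iff₀ hc]
      linarith [(abs_le.1 (h u)).1]
  have hQ : minmaxVal j Q < ⊤ := hupper.trans_lt (ENNReal.mul_lt_top ENNReal.ofReal_lt_top hP)
  refine ⟨hQ, ?_⟩
  have hupper' := ENNReal.toReal_mono (ENNReal.mul_lt_top ENNReal.ofReal_lt_top hP).ne hupper
  have hlower' := ENNReal.toReal_mono (ENNReal.mul_lt_top ENNReal.ofReal_lt_top hQ).ne hlower
  rw [ENNReal.toReal_mul, ENNReal.toReal_ofReal (by linarith)] at hupper'
  rw [ENNReal.toReal_mul, ENNReal.toReal_ofReal (inv_pos.2 hc).le, le_inv_mul_iff₀ hc] at hlower'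
  rw [abs_le]
  constructor <;> linarith

/-- Changing `σ` to `τ` in `(1 - σ) * A + σ * B` is a relative perturbation. -/
theorem abs_convex_comb_sub_le {a b N σ τ : ℝ} (hN : 1 ≤ N) (hb : 0 ≤ b) (hba : b ≤ N * a)
    (hσ0 : 0 ≤ σ) (hσ1 : σ < 1) :
    |((1 - τ) * a + τ * b) - ((1 - σ) * a + σ * b)| ≤
      (1 + N) * |σ - τ| / (1 - σ) * ((1 - σ) * a + σ * b) := by
  have hs : 0 < 1 - σ := by linarith
  have ha : 0 ≤ a := by
    by_contra! ha
    nlinarith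
  have hab : |a - b| ≤ (1 + N) * a := by
    rw [abs_le]
    constructor <;> nlinarith
  calc |((1 - τ) * a + τ * b) - ((1 - σ) * a + σ * b)| = |σ - τ| * |a - b| := by
        rw [← abs_mul]
        ring_nf
    _ ≤ |σ - τ| * ((1 + N) * a) := by gcongr
    _ = (1 + N) * |σ - τ| / (1 - σ) * ((1 - σ) * a) := by field_simp
    _ ≤ (1 + N) * |σ - τ| / (1 - σ) * ((1 - σ) * a + σ * b) := by
        gcongr
        exact le_add_of_nonneg_right (by positivity)

/-- Estimate (eq4) in Step 2 of the proof of Theorem 3.1: local Lipschitz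
continuity of the Neumann eigenvalues in the Poisson ratio. -/
theorem stmt_3 {H : Type*} [NormedAddCommGroup H] [InnerProductSpace ℝ H]
    (j : ℕ) (hj : 1 ≤ j) (hex : ∃ E : Submodule ℝ H, Module.finrank ℝ E = j)
    (N : ℕ) (hN : 1 ≤ N) (A B : H → ℝ)
    (hB : ∀ u, 0 ≤ B u) (hBA : ∀ u, B u ≤ (N : ℝ) * A u)
    (lam : ℝ → ℝ≥0∞)
    (hlam : ∀ σ, lam σ = minmaxVal j (fun u => (1 - σ) * A u + σ * B u))
    (σ₁ σ₂ : ℝ) (hσ₁ : σ₁ ∈ Set.Ico (0 : ℝ) 1) (hσ₂ : σ₂ ∈ Set.Ico (0 : ℝ) 1)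
    (hclose : (1 + (N : ℝ)) * |σ₁ - σ₂| < 1 - min σ₁ σ₂)
    (hfin : lam (min σ₁ σ₂) < ⊤) :
    lam σ₁ < ⊤ ∧ lam σ₂ < ⊤ ∧
      |(lam σ₁).toReal - (lam σ₂).toReal|
        ≤ (1 + (N : ℝ)) * ((lam (min σ₁ σ₂)).toReal / (1 - min σ₁ σ₂)) * |σ₁ - σ₂| := by
  have hN' : (1 : ℝ) ≤ N := by exact_mod_cast hN
  have key : ∀ σ τ : ℝ, 0 ≤ σ → σ < 1 → (1 + (N : ℝ)) * |σ - τ| < 1 - σ → lam σ < ⊤ →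
      lam τ < ⊤ ∧ |(lam σ).toReal - (lam τ).toReal| ≤
        (1 + (N : ℝ)) * ((lam σ).toReal / (1 - σ)) * |σ - τ| := by
    intro σ τ hσ0 hσ1 hστ hσ
    have hs : 0 < 1 - σ := by linarith
    rw [hlam] at hσ
    have hmm := minmaxVal_lt_top_and_abs_sub_le j (Q := fun u => (1 - τ) * A u + τ * B u)
      (c := (1 + (N : ℝ)) * |σ - τ| / (1 - σ)) (by positivity) ((div_lt_one hs).2 hστ)
      (fun u => abs_convex_comb_sub_le hN' (hB u) (hBA u) hσ0 hσ1) hσ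
    rw [← hlam, ← hlam] at hmm
    exact ⟨hmm.1, hmm.2.trans_eq (by ring)⟩
  rcases le_total σ₁ σ₂ with h | h
  · rw [min_eq_left h] at *
    exact ⟨hfin, key σ₁ σ₂ hσ₁.1 hσ₁.2 hclose hfin⟩
  · rw [min_eq_right h] at *
    rw [abs_sub_comm σ₁ σ₂] at *
    rw [abs_sub_comm (lam σ₁).toReal]
    obtain ⟨h₁, h₂⟩ := key σ₂ σ₁ hσ₂.1 hσ₂.2 hclose hfin
    exact ⟨h₁, hfin, h₂⟩
end

section
/- Let H, j, N, A, B, Q_σ, λ_j(σ) be as in the min–max setting. Assume there exists a j-dimensional subspace E₀ of H such that B(u) = 0 for all u ∈ E₀, and such that S := sup { A(u)/‖u‖² : u ∈ E₀, u ≠ 0 } is finite. Then λ_j(σ) ≤ (1−σ)·S for every σ ∈ [0,1]; in particular, λ_j(σ) → 0 as σ → 1⁻. -/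
open scoped ENNReal

/-- Step 1 and estimate (eq1) of the proof of Theorem 3.1: if there is a
`j`-dimensional subspace `E₀` on which `B` vanishes and on which the Rayleigh
quotients of `A` are bounded with supremum `S`, then `λ_j(σ) ≤ (1-σ)·S` for all
`σ ∈ [0,1]`; in particular `λ_j(σ) → 0` as `σ → 1⁻`. -/
theorem stmt_6 {H : Type*} [NormedAddCommGroup H] [InnerProductSpace ℝ H]
    (j : ℕ) (hj : 1 ≤ j) (hex : ∃ E : Submodule ℝ H, Module.finrank ℝ E = j)
    (N : ℕ) (hN : 1 ≤ N) (A B : H → ℝ)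
    (hB : ∀ u, 0 ≤ B u) (hBA : ∀ u, B u ≤ (N : ℝ) * A u)
    (lam : ℝ → ℝ≥0∞)
    (hlam : ∀ σ, lam σ = minmaxVal j (fun u => (1 - σ) * A u + σ * B u))
    (E₀ : Submodule ℝ H) (hE₀ : Module.finrank ℝ E₀ = j)
    (hBE₀ : ∀ u ∈ E₀, B u = 0)
    (Sfin : BddAbove {s : ℝ | ∃ u ∈ E₀, u ≠ 0 ∧ s = A u / ‖u‖ ^ 2})
    (S : ℝ) (hS : S = sSup {s : ℝ | ∃ u ∈ E₀, u ≠ 0 ∧ s = A u / ‖u‖ ^ 2}) :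
    (∀ σ ∈ Set.Icc (0 : ℝ) 1, lam σ ≤ ENNReal.ofReal ((1 - σ) * S)) ∧
      Filter.Tendsto lam (nhdsWithin 1 (Set.Iio 1)) (nhds 0) := by
  subst hS
  have key : ∀ σ ∈ Set.Icc (0 : ℝ) 1, lam σ ≤ ENNReal.ofReal
      ((1 - σ) * sSup {s : ℝ | ∃ u ∈ E₀, u ≠ 0 ∧ s = A u / ‖u‖ ^ 2}) := by
    intro σ hσ
    rw [hlam]
    refine (iInf₂_le E₀ hE₀).trans (iSup_le fun u => iSup₂_le fun hu hu0 => ?_)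
    apply ENNReal.ofReal_le_ofReal
    beta_reduce
    rw [hBE₀ u hu, mul_zero, add_zero, mul_div_assoc]
    exact mul_le_mul_of_nonneg_left (le_csSup Sfin ⟨u, hu, hu0, rfl⟩) (sub_nonneg.2 hσ.2)
  refine ⟨key, ?_⟩
  set S := sSup {s : ℝ | ∃ u ∈ E₀, u ≠ 0 ∧ s = A u / ‖u‖ ^ 2}
  have hlim : Filter.Tendsto (fun σ : ℝ => ENNReal.ofReal ((1 - σ) * S))
      (nhdsWithin 1 (Set.Iio 1)) (nhds 0) := by
    have hcont : Continuous fun σ : ℝ => ENNReal.ofReal ((1 - σ) * S) :=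
      ENNReal.continuous_ofReal.comp (by fun_prop)
    simpa using (hcont.tendsto 1).mono_left nhdsWithin_le_nhds
  refine tendsto_of_tendsto_of_tendsto_of_le_of_le' tendsto_const_nhds hlim
    (Filter.Eventually.of_forall fun _ => zero_le) ?_
  filter_upwards [Ioo_mem_nhdsLT (zero_lt_one' ℝ)] with σ hσ
  exact key σ (Set.Ioo_subset_Icc_self hσ)
end

section
/- Let N ≥ 1 be a natural number, let Ω be a nonempty bounded open subset of the Euclidean space ℝ^N, and let U be an open set containing the closure of Ω. Let μ ∈ ℝ with μ ≠ 0, and let w : ℝ^N → ℝ be smooth on U (ContDiff of order ∞ on U) and satisfy: Δ(Δw)(x) = μ·w(x) for all x ∈ Ω; w(x) = 0 and the Fréchet derivative of w vanishes at x for all x in the topological frontier of Ω. Set v := μ⁻¹·Δw. Then: Δ(Δv)(x) = μ·v(x) for all x ∈ Ω; Δv(x) = 0 and the Fréchet derivative of Δv vanishes at x for all x in the frontier of Ω; moreover, if w is not identically zero on Ω, then v is not identically zero on Ω. -/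
/-- The Laplacian of `f : ℝ^N → ℝ`: the trace of the second derivative,
`Δf(x) = Σ_i ∂²f/∂x_i²(x)`. -/
noncomputable def lap {N : ℕ} (f : EuclideanSpace ℝ (Fin N) → ℝ)
    (x : EuclideanSpace ℝ (Fin N)) : ℝ :=
  ∑ i : Fin N, iteratedFDeriv ℝ 2 f x
    ![EuclideanSpace.single i (1 : ℝ), EuclideanSpace.single i (1 : ℝ)]

theorem lap_congr_nhds {N : ℕ} {f g : EuclideanSpace ℝ (Fin N) → ℝ}
    {x : EuclideanSpace ℝ (Fin N)} (h : f =ᶠ[nhds x] g) : lap f x = lap g x := by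
  simp only [lap, (h.iteratedFDeriv ℝ 2).eq_of_nhds]

theorem lap_const_mul {N : ℕ} {f : EuclideanSpace ℝ (Fin N) → ℝ}
    {x : EuclideanSpace ℝ (Fin N)} (c : ℝ) (hf : ContDiffAt ℝ 2 f x) :
    lap (fun y => c * f y) x = c * lap f x := by
  have h : iteratedFDeriv ℝ 2 (fun y => c * f y) x = c • iteratedFDeriv ℝ 2 f x := by
    simpa only [Pi.smul_def, smul_eq_mul] using iteratedFDeriv_const_smul_apply (a := c) hf
  simp only [lap, h, smul_apply, smul_eq_mul, Finset.mul_sum]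

theorem lap_zero {N : ℕ} (x : EuclideanSpace ℝ (Fin N)) : lap (fun _ => 0) x = 0 := by
  simpa using lap_const_mul (f := fun _ => 0) (x := x) 0 contDiffAt_const

theorem ContDiffAt.lap {N : ℕ} {f : EuclideanSpace ℝ (Fin N) → ℝ}
    {x : EuclideanSpace ℝ (Fin N)} (hf : ContDiffAt ℝ (⊤ : ℕ∞) f x) :
    ContDiffAt ℝ (⊤ : ℕ∞) (lap f) x := by
  have h : ContDiffAt ℝ (⊤ : ℕ∞) (iteratedFDeriv ℝ 2 f) x :=
    hf.iteratedFDeriv_right (by norm_cast)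
  refine ContDiffAt.sum fun i _ => ?_
  exact (ContinuousMultilinearMap.apply ℝ (fun _ : Fin 2 => EuclideanSpace ℝ (Fin N)) ℝ
    ![EuclideanSpace.single i 1, EuclideanSpace.single i 1]).contDiff.contDiffAt.comp x h

/-- Two functions that agree on an open set have the same value and derivative at any point of its
closure where both are `C¹`. -/
theorem Set.EqOn.eq_and_fderiv_eq_of_mem_closure {E F : Type*}
    [NormedAddCommGroup E] [NormedSpace ℝ E] [NormedAddCommGroup F] [NormedSpace ℝ F]
    {f g : E → F} {s : Set E} {x : E} (h : Set.EqOn f g s) (hs : IsOpen s)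
    (hf : ContDiffAt ℝ 1 f x) (hg : ContDiffAt ℝ 1 g x) (hx : x ∈ closure s) :
    f x = g x ∧ fderiv ℝ f x = fderiv ℝ g x := by
  have : (nhdsWithin x s).NeBot := mem_closure_iff_nhdsWithin_neBot.1 hx
  refine ⟨tendsto_nhds_unique_of_eventuallyEq (l := nhdsWithin x s)
      (hf.continuousAt.mono_left nhdsWithin_le_nhds)
      (hg.continuousAt.mono_left nhdsWithin_le_nhds) (eventually_mem_nhdsWithin.mono h),
    tendsto_nhds_unique_of_eventuallyEq (l := nhdsWithin x s)
      ((hf.continuousAt_fderiv one_ne_zero).mono_left nhdsWithin_le_nhds)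
      ((hg.continuousAt_fderiv one_ne_zero).mono_left nhdsWithin_le_nhds)
      (eventually_mem_nhdsWithin.mono fun y hy => ?_)⟩
  exact (h.eventuallyEq_of_mem (hs.mem_nhds hy)).fderiv_eq

/-- One direction of Theorem 3.3: if `w` is a Dirichlet eigenfunction of the
biharmonic operator with eigenvalue `μ ≠ 0`, then `v = Δw/μ` is an eigenfunction
of the `σ = 1` Neumann problem with the same eigenvalue. -/
theorem stmt_9 (N : ℕ) (hN : 1 ≤ N)
    (Ω U : Set (EuclideanSpace ℝ (Fin N)))
    (hΩne : Ω.Nonempty) (hΩopen : IsOpen Ω) (hΩbd : Bornology.IsBounded Ω)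
    (hUopen : IsOpen U) (hUcl : closure Ω ⊆ U)
    (μ : ℝ) (hμ : μ ≠ 0)
    (w : EuclideanSpace ℝ (Fin N) → ℝ) (hw : ContDiffOn ℝ (⊤ : ℕ∞) w U)
    (heig : ∀ x ∈ Ω, lap (lap w) x = μ * w x)
    (hbd : ∀ x ∈ frontier Ω, w x = 0 ∧ fderiv ℝ w x = 0) :
    (∀ x ∈ Ω, lap (lap (fun y => μ⁻¹ * lap w y)) x = μ * (μ⁻¹ * lap w x)) ∧
    (∀ x ∈ frontier Ω, lap (fun y => μ⁻¹ * lap w y) x = 0 ∧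
      fderiv ℝ (lap (fun y => μ⁻¹ * lap w y)) x = 0) ∧
    ((¬ ∀ x ∈ Ω, w x = 0) → ¬ ∀ x ∈ Ω, μ⁻¹ * lap w x = 0) := by
  have hwU : ∀ x ∈ U, ContDiffAt ℝ (⊤ : ℕ∞) w x := fun x hx =>
    hw.contDiffAt (hUopen.mem_nhds hx)
  have hvU : ∀ x ∈ U, ContDiffAt ℝ (⊤ : ℕ∞) (fun y => μ⁻¹ * lap w y) x := fun x hx =>
    contDiffAt_const.mul (hwU x hx).lap
  have hΩU : Ω ⊆ U := subset_closure.trans hUcl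
  have hEq : Set.EqOn (lap (fun y => μ⁻¹ * lap w y)) w Ω := fun x hx => by
    rw [lap_const_mul _ ((hwU x (hΩU hx)).lap.of_le (by norm_cast)), heig x hx,
      inv_mul_cancel_left₀ hμ]
  refine ⟨fun x hx => ?_, fun x hx => ?_, fun hne hv => hne fun x hx => ?_⟩
  · rw [lap_congr_nhds (hEq.eventuallyEq_of_mem (hΩopen.mem_nhds hx)), mul_inv_cancel_left₀ hμ]
  · have hxc := frontier_subset_closure hx
    have hxU := hUcl hxc
    obtain ⟨h₀, h₁⟩ := hEq.eq_and_fderiv_eq_of_mem_closure hΩopen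
      ((hvU x hxU).lap.of_le (by norm_cast))
      ((hwU x hxU).of_le (by norm_cast)) hxc
    exact ⟨h₀.trans (hbd x hx).1, h₁.trans (hbd x hx).2⟩
  · have hv' : Set.EqOn (fun y => μ⁻¹ * lap w y) (fun _ => 0) Ω := hv
    rw [← hEq hx, lap_congr_nhds (hv'.eventuallyEq_of_mem (hΩopen.mem_nhds hx)), lap_zero]
end
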